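/- Let (K_n) be a large financial market with numéraire portfolios (V_n) as in the context. Then the following three conditions are equivalent: (a) NAA holds; (b) lim_{α↓0} lim inf_{n→∞} E_{P_n}[(V_n)^{-α}] = 1 (the limit as α decreases to 0 exists and equals 1); (c) there exists a sequence ζ_n ∈ D_n such that lim_{α↓0} lim inf_{n→∞} E_{P_n}[(ζ_n)^{α}] = 1. -/

import Mathlib

open MeasureTheory Filter Topology ENNReal

/-- `ζ` is an equivalent supermartingale density for the market `K` under `P`. -/
def IsESD {Ω' : Type*} [MeasurableSpace Ω'] (P : Measure Ω')
    (K : Set (Ω' → ℝ)) (ζ : Ω' → ℝ) : Prop :=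
  Measurable ζ ∧ (∀ᵐ ω ∂P, 0 < ζ ω) ∧
    ∀ ξ ∈ K, ∫⁻ ω, ENNReal.ofReal (ζ ω * ξ ω) ∂P ≤ 1

/-- No asymptotic arbitrage for the large market `(K n)`. -/
def NAA {Ω : ℕ → Type*} [∀ n, MeasurableSpace (Ω n)]
    (P : ∀ n, Measure (Ω n)) (K : ∀ n, Set (Ω n → ℝ)) : Prop :=
  ∀ ξ : ∀ n, Ω n → ℝ, (∀ n, ξ n ∈ K n) →
    ∀ lam : ℕ → ℝ, (∀ n, 0 ≤ lam n) → Tendsto lam atTop (𝓝 (0 : ℝ)) →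
      limsup (fun n => P n {ω | 1 ≤ lam n * ξ n ω}) atTop = 0

/-- Young's inequality `x ^ α ≤ α x + (1 - α)` in `ℝ≥0∞`. -/
lemma ofReal_rpow_le_mul_add_one_sub {x α : ℝ} (hx : 0 ≤ x) (hα : 0 < α) (hα1 : α ≤ 1) :
    ENNReal.ofReal (x ^ α) ≤
      ENNReal.ofReal α * ENNReal.ofReal x + ENNReal.ofReal (1 - α) := by
  have h := Real.geom_mean_le_arith_mean2_weighted hα.le (by linarith : (0 : ℝ) ≤ 1 - α) hx
    zero_le_one (by ring)
  rw [Real.one_rpow, mul_one, mul_one] at h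
  rw [← ENNReal.ofReal_mul hα.le, ← ENNReal.ofReal_add (by positivity) (by linarith)]
  exact ENNReal.ofReal_le_ofReal h

lemma ofReal_rpow_le_add_mul {x α ε : ℝ} (hx : 0 ≤ x) (hα : 0 < α) (hα1 : α ≤ 1) (hε : 0 < ε) :
    ENNReal.ofReal (x ^ α) ≤
      ENNReal.ofReal ε + ENNReal.ofReal (1 + (ε ^ α⁻¹)⁻¹) * ENNReal.ofReal x := by
  have ht : 0 < ε ^ α⁻¹ := Real.rpow_pos_of_pos hε _
  rw [← ENNReal.ofReal_mul (by positivity), ← ENNReal.ofReal_add hε.le (by positivity)]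
  refine ENNReal.ofReal_le_ofReal ?_
  rcases le_total x (ε ^ α⁻¹) with h | h
  · have h1 : x ^ α ≤ ε := by
      calc x ^ α ≤ (ε ^ α⁻¹) ^ α := Real.rpow_le_rpow hx h hα.le
        _ = ε := by rw [← Real.rpow_mul hε.le, inv_mul_cancel₀ hα.ne', Real.rpow_one]
    have : 0 ≤ (1 + (ε ^ α⁻¹)⁻¹) * x := by positivity
    linarith
  · have h1 : x ^ α ≤ 1 + x := by
      rcases le_total x 1 with h' | h'
      · linarith [Real.rpow_le_one hx h' hα.le]
      · have := Real.rpow_le_rpow_of_exponent_le h' hα1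
        rw [Real.rpow_one] at this
        linarith
    have h2 : 1 ≤ (ε ^ α⁻¹)⁻¹ * x := by
      rw [inv_mul_eq_div, le_div_iff₀ ht]
      linarith
    nlinarith

lemma measure_add_lintegral_rpow_le {Ω' : Type*} [MeasurableSpace Ω'] (P : Measure Ω')
    [IsProbabilityMeasure P] {ζ : Ω' → ℝ} (hζm : Measurable ζ) (hζ0 : ∀ᵐ ω ∂P, 0 < ζ ω)
    (hζ1 : ∫⁻ ω, ENNReal.ofReal (ζ ω) ∂P ≤ 1) {A : Set Ω'} (hA : MeasurableSet A)
    {l : ℝ≥0∞} (hl : ∫⁻ ω in A, ENNReal.ofReal (ζ ω) ∂P ≤ l)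
    {α ε : ℝ} (hα : 0 < α) (hα1 : α ≤ 1) (hε : 0 < ε) :
    P A + ∫⁻ ω, ENNReal.ofReal (ζ ω ^ α) ∂P ≤
      1 + ENNReal.ofReal α + ENNReal.ofReal ε + ENNReal.ofReal (1 + (ε ^ α⁻¹)⁻¹) * l := by
  have hm : Measurable fun ω => ENNReal.ofReal (ζ ω) := hζm.ennreal_ofReal
  have hin : ∫⁻ ω in A, ENNReal.ofReal (ζ ω ^ α) ∂P ≤
      ENNReal.ofReal ε + ENNReal.ofReal (1 + (ε ^ α⁻¹)⁻¹) * l := by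
    calc ∫⁻ ω in A, ENNReal.ofReal (ζ ω ^ α) ∂P
        ≤ ∫⁻ ω in A, (ENNReal.ofReal ε +
            ENNReal.ofReal (1 + (ε ^ α⁻¹)⁻¹) * ENNReal.ofReal (ζ ω)) ∂P := by
          refine lintegral_mono_ae (ae_restrict_of_ae ?_)
          filter_upwards [hζ0] with ω hω using ofReal_rpow_le_add_mul hω.le hα hα1 hε
      _ = ENNReal.ofReal ε * P A +
            ENNReal.ofReal (1 + (ε ^ α⁻¹)⁻¹) * ∫⁻ ω in A, ENNReal.ofReal (ζ ω) ∂P := by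
          rw [lintegral_add_left measurable_const, lintegral_const_mul _ hm, setLIntegral_const]
      _ ≤ _ := by
          gcongr
          exact mul_le_of_le_one_right' prob_le_one
  have hout : ∫⁻ ω in Aᶜ, ENNReal.ofReal (ζ ω ^ α) ∂P ≤ ENNReal.ofReal α + P Aᶜ := by
    calc ∫⁻ ω in Aᶜ, ENNReal.ofReal (ζ ω ^ α) ∂P
        ≤ ∫⁻ ω in Aᶜ, (ENNReal.ofReal α * ENNReal.ofReal (ζ ω) + 1) ∂P := by
          refine lintegral_mono_ae (ae_restrict_of_ae ?_)
          filter_upwards [hζ0] with ω hω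
          exact (ofReal_rpow_le_mul_add_one_sub hω.le hα hα1).trans
            (by gcongr; exact ENNReal.ofReal_le_one.2 (by linarith))
      _ = ENNReal.ofReal α * ∫⁻ ω in Aᶜ, ENNReal.ofReal (ζ ω) ∂P + P Aᶜ := by
          rw [lintegral_add_right _ measurable_const, lintegral_const_mul _ hm,
            setLIntegral_const, one_mul]
      _ ≤ _ := by
          gcongr
          exact mul_le_of_le_one_right' ((setLIntegral_le_lintegral _ _).trans hζ1)
  calc P A + ∫⁻ ω, ENNReal.ofReal (ζ ω ^ α) ∂P
      = P A + (∫⁻ ω in A, ENNReal.ofReal (ζ ω ^ α) ∂P +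
          ∫⁻ ω in Aᶜ, ENNReal.ofReal (ζ ω ^ α) ∂P) := by rw [lintegral_add_compl _ hA]
    _ ≤ P A + ((ENNReal.ofReal ε + ENNReal.ofReal (1 + (ε ^ α⁻¹)⁻¹) * l) +
          (ENNReal.ofReal α + P Aᶜ)) := by gcongr
    _ = (P A + P Aᶜ) + ENNReal.ofReal α + ENNReal.ofReal ε +
          ENNReal.ofReal (1 + (ε ^ α⁻¹)⁻¹) * l := by ring
    _ = _ := by rw [prob_add_prob_compl hA]

lemma IsESD.setLIntegral_le {Ω' : Type*} [MeasurableSpace Ω'] {P : Measure Ω'}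
    {K : Set (Ω' → ℝ)} {ζ ξ : Ω' → ℝ} (hζ : IsESD P K ζ) (hξ : ξ ∈ K) (hξm : Measurable ξ)
    {l : ℝ} (hl : 0 ≤ l) :
    ∫⁻ ω in {ω | 1 ≤ l * ξ ω}, ENNReal.ofReal (ζ ω) ∂P ≤ ENNReal.ofReal l := by
  have hA : MeasurableSet {ω | 1 ≤ l * ξ ω} := measurableSet_le measurable_const (hξm.const_mul l)
  calc ∫⁻ ω in {ω | 1 ≤ l * ξ ω}, ENNReal.ofReal (ζ ω) ∂P
      ≤ ∫⁻ ω in {ω | 1 ≤ l * ξ ω}, ENNReal.ofReal l * ENNReal.ofReal (ζ ω * ξ ω) ∂P := by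
        refine lintegral_mono_ae ?_
        filter_upwards [ae_restrict_of_ae hζ.2.1, ae_restrict_mem hA] with ω hω hωA
        rw [← ENNReal.ofReal_mul hl]
        refine ENNReal.ofReal_le_ofReal ?_
        have : 1 ≤ l * ξ ω := hωA
        nlinarith
    _ ≤ ∫⁻ ω, ENNReal.ofReal l * ENNReal.ofReal (ζ ω * ξ ω) ∂P := setLIntegral_le_lintegral _ _
    _ = ENNReal.ofReal l * ∫⁻ ω, ENNReal.ofReal (ζ ω * ξ ω) ∂P :=
        lintegral_const_mul _ (hζ.1.mul hξm).ennreal_ofReal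
    _ ≤ _ := mul_le_of_le_one_right' (hζ.2.2 ξ hξ)

lemma NAA.of_tendsto_liminf_lintegral_rpow {Ω : ℕ → Type*} [∀ n, MeasurableSpace (Ω n)]
    {P : ∀ n, Measure (Ω n)} [∀ n, IsProbabilityMeasure (P n)] {K : ∀ n, Set (Ω n → ℝ)}
    (hKmeas : ∀ n, ∀ ξ ∈ K n, Measurable ξ) (hK1 : ∀ n, (fun _ => (1 : ℝ)) ∈ K n)
    {ζ : ∀ n, Ω n → ℝ} (hζ : ∀ n, IsESD (P n) (K n) (ζ n))
    (h : Tendsto (fun α : ℝ => liminf (fun n => ∫⁻ ω, ENNReal.ofReal (ζ n ω ^ α) ∂P n) atTop)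
      (𝓝[>] (0 : ℝ)) (𝓝 1)) : NAA P K := by
  intro ξ hξ lam hlam0 hlam
  suffices H : ∀ δ : ℝ, 0 < δ → δ < 1 →
      ∀ᶠ n in atTop, P n {ω | 1 ≤ lam n * ξ n ω} ≤ ENNReal.ofReal (4 * δ) by
    refine le_antisymm (le_of_forall_gt fun c hc => ?_) zero_le
    obtain ⟨δ, hδ0, hδ1, hδc⟩ : ∃ δ : ℝ, 0 < δ ∧ δ < 1 ∧ ENNReal.ofReal (4 * δ) < c := by
      have ht : Tendsto (fun δ : ℝ => ENNReal.ofReal (4 * δ)) (𝓝[>] 0) (𝓝 0) := by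
        have : Continuous fun δ : ℝ => ENNReal.ofReal (4 * δ) :=
          ENNReal.continuous_ofReal.comp (continuous_const_mul 4)
        simpa using (this.tendsto 0).mono_left nhdsWithin_le_nhds
      have := (ht.eventually_lt_const hc).and
        (Ioo_mem_nhdsGT (zero_lt_one (α := ℝ)))
      obtain ⟨δ, h1, h2⟩ := this.exists
      exact ⟨δ, h2.1, h2.2, h1⟩
    exact (limsup_le_of_le (by isBoundedDefault) (H δ hδ0 hδ1)).trans_lt hδc
  intro δ hδ0 hδ1
  have hlt : ENNReal.ofReal (1 - δ) < 1 := by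
    rw [← ENNReal.ofReal_one]
    exact (ENNReal.ofReal_lt_ofReal_iff zero_lt_one).2 (by linarith)
  obtain ⟨α, hL, hα0, hαδ⟩ :=
    ((h.eventually_const_lt hlt).and (Ioo_mem_nhdsGT hδ0)).exists
  have hC : Tendsto (fun n => ENNReal.ofReal (1 + (δ ^ α⁻¹)⁻¹) * ENNReal.ofReal (lam n))
      atTop (𝓝 0) := by
    have := ENNReal.Tendsto.const_mul (a := ENNReal.ofReal (1 + (δ ^ α⁻¹)⁻¹))
      (ENNReal.tendsto_ofReal hlam) (Or.inr ENNReal.ofReal_ne_top)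
    simpa using this
  filter_upwards [eventually_lt_of_lt_liminf hL,
    hC.eventually_le_const (ENNReal.ofReal_pos.2 hδ0)] with n hn1 hn2
  have hA : MeasurableSet {ω | 1 ≤ lam n * ξ n ω} :=
    measurableSet_le measurable_const ((hKmeas n _ (hξ n)).const_mul _)
  have hζ1 : ∫⁻ ω, ENNReal.ofReal (ζ n ω) ∂P n ≤ 1 := by simpa using (hζ n).2.2 _ (hK1 n)
  have key := measure_add_lintegral_rpow_le (P n) (hζ n).1 (hζ n).2.1 hζ1 hA
    ((hζ n).setLIntegral_le (hξ n) (hKmeas n _ (hξ n)) (hlam0 n)) hα0 (by linarith) hδ0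
  refine (ENNReal.add_le_add_iff_right (ENNReal.ofReal_ne_top (r := 1 - δ))).1 ?_
  calc P n {ω | 1 ≤ lam n * ξ n ω} + ENNReal.ofReal (1 - δ)
      ≤ P n {ω | 1 ≤ lam n * ξ n ω} + ∫⁻ ω, ENNReal.ofReal (ζ n ω ^ α) ∂P n := by gcongr
    _ ≤ 1 + ENNReal.ofReal δ + ENNReal.ofReal δ + ENNReal.ofReal δ :=
        key.trans (by gcongr)
    _ = ENNReal.ofReal (4 * δ) + ENNReal.ofReal (1 - δ) := by
        rw [← ENNReal.ofReal_one, ← ENNReal.ofReal_add, ← ENNReal.ofReal_add,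
          ← ENNReal.ofReal_add, ← ENNReal.ofReal_add]
        · congr 1
          ring
        all_goals linarith

lemma tendsto_extend_zero {φ : ℕ → ℕ} (hφ : StrictMono φ) {u : ℕ → ℝ}
    (hu : Tendsto u atTop (𝓝 0)) : Tendsto (Function.extend φ u 0) atTop (𝓝 0) := by
  refine Metric.tendsto_atTop.2 fun ε hε => ?_
  obtain ⟨N, hN⟩ := Metric.tendsto_atTop.1 hu ε hε
  refine ⟨φ N, fun m hm => ?_⟩
  by_cases hk : ∃ k, φ k = m
  · obtain ⟨k, rfl⟩ := hk
    rw [hφ.injective.extend_apply]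
    exact hN k (hφ.le_iff_le.1 hm)
  · rw [Function.extend_apply' _ _ _ hk]
    simpa using hε

/-- Under NAA, every sequence of admissible portfolios is bounded in probability. -/
lemma NAA.exists_eventually_measure_le {Ω : ℕ → Type*} [∀ n, MeasurableSpace (Ω n)]
    {P : ∀ n, Measure (Ω n)} {K : ∀ n, Set (Ω n → ℝ)} (h : NAA P K)
    {ξ : ∀ n, Ω n → ℝ} (hξ : ∀ n, ξ n ∈ K n) {δ : ℝ≥0∞} (hδ : 0 < δ) :
    ∃ k : ℕ, ∀ᶠ n in atTop, P n {ω | (k : ℝ) + 1 ≤ ξ n ω} ≤ δ := by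
  by_contra! hcon
  have hfreq : ∀ k : ℕ, ∃ᶠ n in atTop, δ < P n {ω | (k : ℝ) + 1 ≤ ξ n ω} := fun k => by
    simpa [Filter.Frequently, not_lt] using hcon k
  obtain ⟨φ, hφ, hφδ⟩ := extraction_forall_of_frequently hfreq
  set u : ℕ → ℝ := fun k => 1 / ((k : ℝ) + 1) with hu
  have hnonneg : ∀ m, 0 ≤ Function.extend φ u 0 m := fun m => by
    by_cases hk : ∃ k, φ k = m
    · obtain ⟨k, rfl⟩ := hk
      rw [hφ.injective.extend_apply]
      positivity
    · rw [Function.extend_apply' _ _ _ hk]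
      rfl
  have h0 := h ξ hξ _ hnonneg (tendsto_extend_zero hφ tendsto_one_div_add_atTop_nhds_zero_nat)
  have hle : δ ≤ limsup (fun n => P n {ω | 1 ≤ Function.extend φ u 0 n * ξ n ω}) atTop := by
    refine le_limsup_of_frequently_le ?_ (by isBoundedDefault)
    refine hφ.tendsto_atTop.frequently (Frequently.of_forall fun k => (hφδ k).le.trans ?_)
    refine measure_mono fun ω hω => ?_
    have hω' : (k : ℝ) + 1 ≤ ξ (φ k) ω := hω
    simp only [Set.mem_ofPred_eq, hφ.injective.extend_apply, hu]
    rw [one_div_mul_eq_div, le_div_iff₀ (by positivity)]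
    linarith
  exact (hδ.trans_le hle).ne' h0

lemma lintegral_rpow_neg_le_one {Ω' : Type*} [MeasurableSpace Ω'] (P : Measure Ω')
    [IsProbabilityMeasure P] {V : Ω' → ℝ} (hVm : Measurable V) (hV0 : ∀ᵐ ω ∂P, 0 < V ω)
    (hV1 : ∫⁻ ω, ENNReal.ofReal (1 / V ω) ∂P ≤ 1) {α : ℝ} (hα : 0 < α) (hα1 : α ≤ 1) :
    ∫⁻ ω, ENNReal.ofReal (V ω ^ (-α)) ∂P ≤ 1 := by
  have hm : Measurable fun ω => ENNReal.ofReal (1 / V ω) :=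
    (measurable_const.div hVm).ennreal_ofReal
  calc ∫⁻ ω, ENNReal.ofReal (V ω ^ (-α)) ∂P
      ≤ ∫⁻ ω, (ENNReal.ofReal α * ENNReal.ofReal (1 / V ω) + ENNReal.ofReal (1 - α)) ∂P := by
        refine lintegral_mono_ae ?_
        filter_upwards [hV0] with ω hω
        rw [Real.rpow_neg hω.le, ← Real.inv_rpow hω.le, ← one_div]
        exact ofReal_rpow_le_mul_add_one_sub (by positivity) hα hα1
    _ = ENNReal.ofReal α * ∫⁻ ω, ENNReal.ofReal (1 / V ω) ∂P + ENNReal.ofReal (1 - α) := by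
        rw [lintegral_add_right _ measurable_const, lintegral_const_mul _ hm, lintegral_const,
          measure_univ, mul_one]
    _ ≤ ENNReal.ofReal α + ENNReal.ofReal (1 - α) := by
        gcongr
        exact mul_le_of_le_one_right' hV1
    _ = 1 := by
        rw [← ENNReal.ofReal_add hα.le (by linarith)]
        simp

lemma mul_measure_compl_le_lintegral_rpow_neg {Ω' : Type*} [MeasurableSpace Ω'] (P : Measure Ω')
    {V : Ω' → ℝ} (hVm : Measurable V) (hV0 : ∀ᵐ ω ∂P, 0 < V ω) (M : ℝ)
    {α : ℝ} (hα : 0 < α) :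
    ENNReal.ofReal (M ^ (-α)) * P {ω | M ≤ V ω}ᶜ ≤
      ∫⁻ ω, ENNReal.ofReal (V ω ^ (-α)) ∂P := by
  have hA : MeasurableSet {ω | M ≤ V ω}ᶜ := (measurableSet_le measurable_const hVm).compl
  rw [← setLIntegral_const]
  refine le_trans (lintegral_mono_ae ?_) (setLIntegral_le_lintegral {ω | M ≤ V ω}ᶜ _)
  filter_upwards [ae_restrict_of_ae hV0, ae_restrict_mem hA] with ω hω hωA
  have hlt : V ω < M := not_le.1 hωA
  exact ENNReal.ofReal_le_ofReal (Real.rpow_le_rpow_of_nonpos hω hlt.le (by linarith))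

lemma NAA.tendsto_liminf_lintegral_rpow_neg {Ω : ℕ → Type*} [∀ n, MeasurableSpace (Ω n)]
    {P : ∀ n, Measure (Ω n)} [∀ n, IsProbabilityMeasure (P n)] {K : ∀ n, Set (Ω n → ℝ)}
    (h : NAA P K) {V : ∀ n, Ω n → ℝ} (hVK : ∀ n, V n ∈ K n) (hVm : ∀ n, Measurable (V n))
    (hVpos : ∀ n, ∀ᵐ ω ∂P n, 0 < V n ω)
    (hV1 : ∀ n, ∫⁻ ω, ENNReal.ofReal (1 / V n ω) ∂P n ≤ 1) :
    Tendsto (fun α : ℝ => liminf (fun n => ∫⁻ ω, ENNReal.ofReal (V n ω ^ (-α)) ∂P n) atTop)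
      (𝓝[>] (0 : ℝ)) (𝓝 1) := by
  refine tendsto_order.2 ⟨fun a ha => ?_, fun b hb => ?_⟩
  · obtain ⟨c, hac, hc1⟩ := exists_between ha
    obtain ⟨k, hk⟩ := h.exists_eventually_measure_le hVK (tsub_pos_of_lt hc1)
    have ht : Tendsto (fun α : ℝ => ENNReal.ofReal (((k : ℝ) + 1) ^ (-α)) * c)
        (𝓝[>] 0) (𝓝 c) := by
      have hk0 : (k : ℝ) + 1 ≠ 0 := by positivity
      have h1 : Tendsto (fun α : ℝ => ((k : ℝ) + 1) ^ (-α)) (𝓝[>] 0) (𝓝 1) := by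
        have : Continuous fun α : ℝ => ((k : ℝ) + 1) ^ (-α) :=
          continuous_const.rpow continuous_neg fun _ => Or.inl hk0
        simpa using (this.tendsto 0).mono_left nhdsWithin_le_nhds
      simpa using ENNReal.Tendsto.mul_const (b := c) (ENNReal.tendsto_ofReal h1)
        (Or.inr (hc1.trans ENNReal.one_lt_top).ne)
    filter_upwards [ht.eventually_const_lt hac, self_mem_nhdsWithin] with α hα hα0
    refine hα.trans_le (le_liminf_of_le (by isBoundedDefault) ?_)
    filter_upwards [hk] with n hn
    refine le_trans ?_
      (mul_measure_compl_le_lintegral_rpow_neg (P n) (hVm n) (hVpos n) ((k : ℝ) + 1) hα0)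
    gcongr
    rw [prob_compl_eq_one_sub (measurableSet_le measurable_const (hVm n))]
    calc c = 1 - (1 - c) := (ENNReal.sub_sub_cancel ENNReal.one_ne_top hc1.le).symm
      _ ≤ _ := tsub_le_tsub_left hn 1
  · filter_upwards [Ioo_mem_nhdsGT (zero_lt_one (α := ℝ))] with α hα
    refine lt_of_le_of_lt ?_ hb
    exact liminf_le_of_frequently_le' (Frequently.of_forall fun n =>
      lintegral_rpow_neg_le_one (P n) (hVm n) (hVpos n) (hV1 n) hα.1 hα.2.le)

/-- Theorem 3: in a large market `(K n)` with numéraire portfolios `(V n)`, the conditions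
(a) NAA, (b) `lim_{α↓0} liminf_n E[(V_n)^{-α}] = 1`, and (c) existence of a sequence of
equivalent supermartingale densities `ζ_n` with `lim_{α↓0} liminf_n E[(ζ_n)^α] = 1`,
are all equivalent. -/
theorem naa_hellinger_tfae {Ω : ℕ → Type*} [∀ n, MeasurableSpace (Ω n)]
    (P : ∀ n, Measure (Ω n)) (hP : ∀ n, IsProbabilityMeasure (P n))
    (K : ∀ n, Set (Ω n → ℝ))
    (hKmeas : ∀ n, ∀ ξ ∈ K n, Measurable ξ)
    (hKnonneg : ∀ n, ∀ ξ ∈ K n, ∀ ω, 0 ≤ ξ ω)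
    (hK1 : ∀ n, (fun _ => (1 : ℝ)) ∈ K n)
    (V : ∀ n, Ω n → ℝ) (hVK : ∀ n, V n ∈ K n)
    (hVpos : ∀ n, ∀ᵐ ω ∂P n, 0 < V n ω)
    (hVnum : ∀ n, ∀ ξ ∈ K n, ∫⁻ ω, ENNReal.ofReal (ξ ω / V n ω) ∂P n ≤ 1) :
    List.TFAE [
      NAA P K,
      Tendsto (fun α : ℝ =>
          liminf (fun n => ∫⁻ ω, ENNReal.ofReal (V n ω ^ (-α)) ∂P n) atTop)
        (𝓝[>] (0 : ℝ)) (𝓝 1),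
      ∃ ζ : ∀ n, Ω n → ℝ, (∀ n, IsESD (P n) (K n) (ζ n)) ∧
        Tendsto (fun α : ℝ =>
            liminf (fun n => ∫⁻ ω, ENNReal.ofReal (ζ n ω ^ α) ∂P n) atTop)
          (𝓝[>] (0 : ℝ)) (𝓝 1)] := by
  have := hP
  tfae_have 1 → 2 := fun h =>
    h.tendsto_liminf_lintegral_rpow_neg hVK (fun n => hKmeas n _ (hVK n)) hVpos
      (fun n => hVnum n _ (hK1 n))
  tfae_have 2 → 3 := fun h => by
    refine ⟨fun n ω => (V n ω)⁻¹, fun n => ⟨(hKmeas n _ (hVK n)).inv, ?_, fun ξ hξ => ?_⟩, ?_⟩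
    · filter_upwards [hVpos n] with ω hω using inv_pos.2 hω
    · simpa only [inv_mul_eq_div] using hVnum n ξ hξ
    · refine h.congr fun α => ?_
      simp_rw [Real.inv_rpow (hKnonneg _ _ (hVK _) _), Real.rpow_neg (hKnonneg _ _ (hVK _) _)]
  tfae_have 3 → 1 := fun ⟨_, hζ, h⟩ => NAA.of_tendsto_liminf_lintegral_rpow hKmeas hK1 hζ h
  tfae_finish
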